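/- arXiv:1210.6286 — 3 statements merged into one kernel-verified Lean document; each statement's English description precedes it below -/
import Mathlib

section
/- Let b ∈ {0,1}, let n ≥ 1, and let v : Fin n → {0,1} be a sequence of inputs to one-bit Swap operations. Suppose r : Fin n → ℕ (the round numbers of the linearized operations) satisfies: (i) r 0 = b or r 0 = b + 1; (ii) for every k with k + 1 < n, r (k+1) = r k or r (k+1) = r k + 1; and (iii) r k % 2 = v k for every k. Define the output out k of the k-th operation by: out k = v k if r k = b; otherwise out k = 1 - v k if k = 0 or r (k-1) < r k (i.e., the operation is first in its round), and out k = v k otherwise (i.e., some earlier operation has the same round). Then the outputs satisfy the sequential specification of a one-bit Swap object initialized to b: out 0 = b, and out (k+1) = v k for every k with k + 1 < n. -/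
/-- **Linearized outputs of Algorithm 1 satisfy the sequential Swap specification.**
Let `b ∈ {0,1}`, `n ≥ 1`, and `v : Fin n → {0,1}` be the inputs of the linearized
Swap operations.  Suppose the round numbers `r : Fin n → ℕ` satisfy
(i) `r 0 = b` or `r 0 = b + 1`,
(ii) each round number equals the previous one or the previous one plus one, and
(iii) `r k % 2 = v k` for all `k`.
Define the output `out k` as: `v k` if `r k = b`; otherwise `1 - v k` if the
operation is first in its round (`k = 0` or `r (k-1) < r k`), and `v k` otherwise.
Then `out 0 = b` and `out (k+1) = v k`, i.e. the outputs satisfy the sequential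
specification of a one-bit Swap object initialized to `b`. -/
theorem swap_linearization_satisfies_sequential_spec
    (b : ℕ) (hb : b ≤ 1) (n : ℕ) (hn : 1 ≤ n)
    (v r out : Fin n → ℕ)
    (hv : ∀ k, v k ≤ 1)
    (hr0 : r ⟨0, hn⟩ = b ∨ r ⟨0, hn⟩ = b + 1)
    (hrstep : ∀ (k : ℕ) (hk : k + 1 < n),
      r ⟨k + 1, hk⟩ = r ⟨k, by omega⟩ ∨ r ⟨k + 1, hk⟩ = r ⟨k, by omega⟩ + 1)
    (hpar : ∀ k, r k % 2 = v k)
    (hout : ∀ k : Fin n, out k =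
      if r k = b then v k
      else if k.val = 0 ∨ r ⟨k.val - 1, by have := k.isLt; omega⟩ < r k then 1 - v k
      else v k) :
    out ⟨0, hn⟩ = b ∧
      ∀ (k : ℕ) (hk : k + 1 < n), out ⟨k + 1, hk⟩ = v ⟨k, by omega⟩ := by
  have hge : ∀ (k : ℕ) (hk : k < n), b ≤ r ⟨k, hk⟩ := by
    intro k
    induction k with
    | zero => intro hk; rcases hr0 with h | h <;> omega
    | succ k ih =>
      intro hk
      have h1 := ih (by omega)
      rcases hrstep k hk with h | h <;> omega
  constructor
  · have h := hout ⟨0, hn⟩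
    have hp := hpar ⟨0, hn⟩
    simp only [true_or, if_true] at h
    split_ifs at h <;> omega
  · intro k hk
    have h := hout ⟨k + 1, hk⟩
    have hp := hpar ⟨k + 1, hk⟩
    have hq := hpar ⟨k, by omega⟩
    have hg := hge k (by omega)
    have hs := hrstep k hk
    simp only [Nat.add_sub_cancel, Nat.add_eq_zero_iff, one_ne_zero, and_false, false_or] at h
    split_ifs at h <;> omega
end

section
/- Model the data structure of Algorithm 1 as a state (m, T) where m : ℕ is the value of the max register maxRound and T : ℕ → Bool records which test-and-set bits are set. Define the step function on input v ∈ {0,1}: let r = m if m % 2 = v and r = m + 1 otherwise; the operation outputs v if T r = true and outputs 1 - v if T r = false; the new state is (r, T') where T' agrees with T except T' r = true. Let b ∈ {0,1} and start from the initial state m = b, T b = true, and T j = false for all j ≠ b. Then for any n ≥ 1 and any input sequence v : Fin n → {0,1}, executing the n steps sequentially produces outputs out with out 0 = b and out (k+1) = v k for all k with k + 1 < n. -/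
/-- One step of Algorithm 1 on the state `(m, T)` with input `v`:
let `r = m` if `m % 2 = v` and `r = m + 1` otherwise; the output is `v` if
`T r = true` and `1 - v` if `T r = false`; the new state is `(r, T')` where
`T'` agrees with `T` except that `T' r = true`. -/
def swapStep (s : ℕ × (ℕ → Bool)) (v : ℕ) : (ℕ × (ℕ → Bool)) × ℕ :=
  let r := if s.1 % 2 = v then s.1 else s.1 + 1
  ((r, Function.update s.2 r true), if s.2 r then v else 1 - v)

/-- The state `(maxRound, test-and-set bits)` of Algorithm 1 after sequentially
processing the inputs `v 0, …, v (k-1)`, starting from the initial state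
`m = b`, `T b = true`, and `T j = false` for `j ≠ b`. -/
def swapState (b : ℕ) (v : ℕ → ℕ) : ℕ → ℕ × (ℕ → Bool)
  | 0 => (b, fun j => j == b)
  | k + 1 => (swapStep (swapState b v k) (v k)).1

/-- The output of the `k`-th sequential execution of Algorithm 1. -/
def swapOut (b : ℕ) (v : ℕ → ℕ) (k : ℕ) : ℕ :=
  (swapStep (swapState b v k) (v k)).2

theorem swapStep_spec (s : ℕ × (ℕ → Bool)) (v : ℕ) (hv : v ≤ 1)
    (h1 : s.2 s.1 = true) (h2 : ∀ j, s.1 < j → s.2 j = false) :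
    (swapStep s v).2 = s.1 % 2 ∧ (swapStep s v).1.1 % 2 = v ∧
    (swapStep s v).1.2 (swapStep s v).1.1 = true ∧
    ∀ j, (swapStep s v).1.1 < j → (swapStep s v).1.2 j = false := by
  have h3 := h2 (s.1 + 1) (by omega)
  by_cases h : s.1 % 2 = v
  · simp only [swapStep, h, if_true, h1, Function.update_self, true_and]
    intro j hj
    rw [Function.update_of_ne (by omega)]
    exact h2 j hj
  · simp only [swapStep, h, if_false, h3, Function.update_self, true_and]
    refine ⟨by simp; omega, by omega, ?_⟩
    intro j hj
    rw [Function.update_of_ne (by omega)]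
    exact h2 j (by omega)

theorem swapState_inv (b : ℕ) (n : ℕ) (v : ℕ → ℕ) (hv : ∀ k < n, v k ≤ 1) :
    ∀ k, k ≤ n → (swapState b v k).2 (swapState b v k).1 = true ∧
      ∀ j, (swapState b v k).1 < j → (swapState b v k).2 j = false := by
  intro k
  induction k with
  | zero =>
    intro _
    refine ⟨by simp [swapState], ?_⟩
    intro j hj
    simp only [swapState] at hj ⊢
    simp
    omega
  | succ k ih =>
    intro hk
    obtain ⟨h1, h2⟩ := ih (by omega)
    exact (swapStep_spec _ (v k) (hv k (by omega)) h1 h2).2.2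

/-- **Sequential correctness of Algorithm 1.**
Let `b ∈ {0,1}` and start from the state `m = b`, `T b = true`, `T j = false`
for `j ≠ b`.  Then for any `n ≥ 1` and any input sequence `v : Fin n → {0,1}`
(modeled as `v : ℕ → ℕ` with `v k ≤ 1` for `k < n`), executing the `n` steps
sequentially produces outputs `out` with `out 0 = b` and `out (k+1) = v k` for
all `k` with `k + 1 < n`. -/
theorem swap_sequential_correct (b : ℕ) (hb : b ≤ 1) (n : ℕ) (hn : 1 ≤ n)
    (v : ℕ → ℕ) (hv : ∀ k < n, v k ≤ 1) :
    swapOut b v 0 = b ∧ ∀ k, k + 1 < n → swapOut b v (k + 1) = v k := by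
  refine ⟨?_, fun k hk => ?_⟩
  · obtain ⟨h1, h2⟩ := swapState_inv b n v hv 0 (by omega)
    have h := (swapStep_spec _ (v 0) (hv 0 (by omega)) h1 h2).1
    unfold swapOut
    rw [h]
    simp only [swapState]
    omega
  · obtain ⟨h1, h2⟩ := swapState_inv b n v hv k (by omega)
    obtain ⟨h3, h4⟩ := swapState_inv b n v hv (k + 1) (by omega)
    have h := (swapStep_spec _ (v (k + 1)) (hv (k + 1) (by omega)) h3 h4).1
    unfold swapOut
    rw [h]
    exact (swapStep_spec _ (v k) (hv k (by omega)) h1 h2).2.1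
end

section
/- Model Algorithm 1 sequentially: the max register value after processing inputs v_0, ..., v_{k-1} ∈ {0,1} starting from initial value b ∈ {0,1} is defined by m_0 = b and m_{k+1} = m_k if m_k % 2 = v_k, and m_{k+1} = m_k + 1 otherwise. Then for every n, m_n = b + |{k < n : v_k ≠ w_k}|, where w_0 = b and w_k = v_{k-1} for k ≥ 1; that is, the final max register value equals b plus the number of positions at which the input differs from the previous input (treating the initial value b as the input preceding v_0). -/
/-- The value of the max register `maxRound` of Algorithm 1 after sequentially
processing the inputs `v 0, …, v (k-1)`, starting from initial value `b`:
`m 0 = b`, and `m (k+1) = m k` if `m k % 2 = v k`, `m (k+1) = m k + 1`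
otherwise. -/
def maxRound (b : ℕ) (v : ℕ → ℕ) : ℕ → ℕ
  | 0 => b
  | k + 1 => if (maxRound b v k) % 2 = v k then maxRound b v k else maxRound b v k + 1

/-- **The max register counts the number of value changes of the Swap object.**
For `b ∈ {0,1}` and inputs `v 0, …, v (n-1) ∈ {0,1}`, the max register value
after `n` sequential operations of Algorithm 1 equals `b` plus the number of
positions `k < n` at which the input `v k` differs from the previous input
`w k`, where `w 0 = b` and `w k = v (k-1)` for `k ≥ 1`. -/
theorem maxRound_eq_add_card_changes (b : ℕ) (hb : b ≤ 1) (v : ℕ → ℕ) (n : ℕ)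
    (hv : ∀ k < n, v k ≤ 1) (w : ℕ → ℕ)
    (hw0 : w 0 = b) (hw : ∀ k, 1 ≤ k → w k = v (k - 1)) :
    maxRound b v n = b + ((Finset.range n).filter (fun k => v k ≠ w k)).card := by
  have key : maxRound b v n % 2 = w n ∧
      maxRound b v n = b + ((Finset.range n).filter (fun k => v k ≠ w k)).card := by
    induction n with
    | zero =>
      simp only [maxRound, Finset.range_zero, Finset.filter_empty, Finset.card_empty]
      omega
    | succ k ih =>
      obtain ⟨h1, h2⟩ := ih (fun j hj => hv j (by omega))
      have hk := hv k (by omega)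
      have hwk : w (k + 1) = v k := by simpa using hw (k + 1) (by omega)
      rw [Finset.range_add_one, Finset.filter_insert]
      by_cases h : v k = w k
      · have h3 : maxRound b v (k + 1) = maxRound b v k := by
          simp only [maxRound]
          rw [if_pos (by omega)]
        rw [if_neg (by simpa using h), h3]
        exact ⟨by omega, h2⟩
      · have h3 : maxRound b v (k + 1) = maxRound b v k + 1 := by
          simp only [maxRound]
          rw [if_neg (by omega)]
        rw [if_pos h, Finset.card_insert_of_notMem (by simp), h3]
        exact ⟨by omega, by omega⟩
  exact key.2
end
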